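/- Let λ > 0 and let b_n > 0 solve √(π/2) b_n exp(b_n²/2) = n with a_n = 1/b_n. Then there exists a constant C_λ > 0 such that for all n ≥ 9, sup_{x∈ℝ} |F_λ^n(a_n x + b_n) - exp(-e^{-x})| < C_λ / log n. -/

import Mathlib

open Real MeasureTheory Filter

noncomputable def stdPhi (x : ℝ) : ℝ := (Real.sqrt (2 * Real.pi))⁻¹ * Real.exp (-x ^ 2 / 2)

noncomputable def stdCdf (x : ℝ) : ℝ := ∫ t in Set.Iic x, stdPhi t

noncomputable def snCdf (l x : ℝ) : ℝ := ∫ t in Set.Iic x, 2 * stdPhi t * stdCdf (l * t)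

lemma stdPhi_eq_gaussianPDFReal : stdPhi = ProbabilityTheory.gaussianPDFReal 0 1 := by
  ext x
  simp [stdPhi, ProbabilityTheory.gaussianPDFReal]

lemma stdPhi_pos (x : ℝ) : 0 < stdPhi x := by
  unfold stdPhi
  positivity

lemma stdPhi_neg (x : ℝ) : stdPhi (-x) = stdPhi x := by
  simp [stdPhi]

lemma hasDerivAt_stdPhi (x : ℝ) : HasDerivAt stdPhi (-x * stdPhi x) x := by
  unfold stdPhi
  have h : HasDerivAt (fun x : ℝ => -x ^ 2 / 2) (-x) x := by
    refine (((hasDerivAt_pow 2 x).neg).div_const 2).congr_deriv ?_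
    norm_num
    ring
  refine (h.exp.const_mul _).congr_deriv ?_
  ring

lemma continuous_stdPhi : Continuous stdPhi :=
  continuous_iff_continuousAt.2 fun x => (hasDerivAt_stdPhi x).continuousAt

lemma integrable_stdPhi : Integrable stdPhi :=
  stdPhi_eq_gaussianPDFReal ▸ ProbabilityTheory.integrable_gaussianPDFReal 0 1

lemma integral_stdPhi : ∫ t, stdPhi t = 1 :=
  stdPhi_eq_gaussianPDFReal ▸ ProbabilityTheory.integral_gaussianPDFReal_eq_one 0 one_ne_zero

lemma tendsto_stdPhi_atTop : Tendsto stdPhi atTop (nhds 0) := by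
  have h : Tendsto (fun x : ℝ => -x ^ 2 / 2) atTop atBot := by
    have := (tendsto_pow_atTop (α := ℝ) two_ne_zero).atTop_div_const (zero_lt_two' ℝ)
    exact (tendsto_neg_atTop_atBot.comp this).congr fun x => by simp [neg_div]
  have := (Real.tendsto_exp_atBot.comp h).const_mul (Real.sqrt (2 * Real.pi))⁻¹
  rwa [mul_zero] at this

lemma hasDerivAt_integral_Iic {g : ℝ → ℝ} (hg : Continuous g) (hi : Integrable g) (x : ℝ) :
    HasDerivAt (fun x => ∫ t in Set.Iic x, g t) (g x) x := by
  have h : (fun x => ∫ t in Set.Iic x, g t) =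
      fun x => (∫ t in Set.Iic 0, g t) + ∫ t in (0 : ℝ)..x, g t := by
    ext x
    rw [← intervalIntegral.integral_Iic_sub_Iic hi.integrableOn hi.integrableOn]
    ring
  rw [h]
  exact (intervalIntegral.integral_hasDerivAt_right (hg.intervalIntegrable _ _)
    (hg.stronglyMeasurableAtFilter _ _) hg.continuousAt).const_add _

lemma tendsto_integral_Iic {g : ℝ → ℝ} (hi : Integrable g) :
    Tendsto (fun x => ∫ t in Set.Iic x, g t) atTop (nhds (∫ t, g t)) :=
  (aecover_Iic tendsto_id).integral_tendsto_of_countably_generated hi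

lemma nonneg_of_deriv_nonpos_of_tendsto_zero {f f' : ℝ → ℝ}
    (hf : ∀ x, 0 < x → HasDerivAt f (f' x) x) (hf' : ∀ x, 0 < x → f' x ≤ 0)
    (hlim : Tendsto f atTop (nhds 0)) {x : ℝ} (hx : 0 < x) : 0 ≤ f x := by
  have hanti : AntitoneOn f (Set.Ioi 0) := by
    refine antitoneOn_of_deriv_nonpos (convex_Ioi 0)
      (fun y hy => (hf y hy).continuousAt.continuousWithinAt) ?_ ?_
    · rw [interior_Ioi]
      exact fun y hy => (hf y hy).differentiableAt.differentiableWithinAt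
    · rw [interior_Ioi]
      exact fun y hy => (hf y hy).deriv ▸ hf' y hy
  refine le_of_tendsto hlim ?_
  filter_upwards [eventually_ge_atTop x] with y hy
  exact hanti hx (hx.trans_le hy) hy

lemma hasDerivAt_stdCdf (x : ℝ) : HasDerivAt stdCdf (stdPhi x) x :=
  hasDerivAt_integral_Iic continuous_stdPhi integrable_stdPhi x

lemma continuous_stdCdf : Continuous stdCdf :=
  continuous_iff_continuousAt.2 fun x => (hasDerivAt_stdCdf x).continuousAt

lemma stdCdf_nonneg (x : ℝ) : 0 ≤ stdCdf x :=
  setIntegral_nonneg measurableSet_Iic fun t _ => (stdPhi_pos t).le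

lemma stdCdf_neg (x : ℝ) : stdCdf (-x) = 1 - stdCdf x := by
  have h := intervalIntegral.integral_Iic_add_Ioi (b := x)
    integrable_stdPhi.integrableOn integrable_stdPhi.integrableOn
  have h2 := integral_comp_neg_Iic (-x) stdPhi
  simp only [stdPhi_neg, neg_neg] at h2
  rw [integral_stdPhi, ← h2] at h
  unfold stdCdf
  linarith

lemma stdCdf_le_one (x : ℝ) : stdCdf x ≤ 1 := by
  have := stdCdf_nonneg (-x)
  rw [stdCdf_neg] at this
  linarith

lemma tendsto_stdCdf_atTop : Tendsto stdCdf atTop (nhds 1) :=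
  integral_stdPhi ▸ tendsto_integral_Iic integrable_stdPhi

lemma one_sub_stdCdf_le {z : ℝ} (hz : 0 < z) : 1 - stdCdf z ≤ 1 / z ^ 2 := by
  have hlim : Tendsto (fun z : ℝ => stdCdf z - 1 + 1 * (z⁻¹) ^ 2) atTop (nhds 0) := by
    simpa using (tendsto_stdCdf_atTop.sub_const 1).add ((tendsto_inv_atTop_zero.pow 2).const_mul 1)
  have := nonneg_of_deriv_nonpos_of_tendsto_zero (f := fun z : ℝ => stdCdf z - 1 + 1 * (z⁻¹) ^ 2)
    (f' := fun z => stdPhi z - 2 / z ^ 3) (fun x hx => ?_) (fun x hx => ?_) hlim hz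
  · have e : 1 / z ^ 2 = 1 * (z⁻¹) ^ 2 := by field_simp
    linarith
  · refine (((hasDerivAt_stdCdf x).sub_const 1).add
      (((hasDerivAt_inv hx.ne').pow 2).const_mul 1)).congr_deriv ?_
    simp only [Nat.cast_ofNat, Nat.add_one_sub_one, pow_one]
    field_simp
    ring
  · have h1 : stdPhi x ≤ Real.exp (-(x ^ 2 / 2)) := by
      unfold stdPhi
      rw [neg_div]
      refine mul_le_of_le_one_left (Real.exp_pos _).le (inv_le_one_of_one_le₀ ?_)
      rw [Real.one_le_sqrt]
      linarith [Real.pi_gt_three]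
    have h2 : x ^ 3 / 2 ≤ Real.exp (x ^ 2 / 2) := by
      have := Real.quadratic_le_exp_of_nonneg (x := x ^ 2 / 2) (by positivity)
      nlinarith [sq_nonneg (x ^ 2 / 2 - x), sq_nonneg (x - 1)]
    have h3 : Real.exp (-(x ^ 2 / 2)) ≤ 2 / x ^ 3 := by
      rw [Real.exp_neg, inv_le_comm₀ (Real.exp_pos _) (by positivity), inv_div]
      exact h2
    linarith

lemma continuous_snPdf (l : ℝ) : Continuous fun t => 2 * stdPhi t * stdCdf (l * t) := by
  have := continuous_stdPhi
  have := continuous_stdCdf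
  fun_prop

lemma snPdf_nonneg (l t : ℝ) : 0 ≤ 2 * stdPhi t * stdCdf (l * t) :=
  mul_nonneg (mul_nonneg zero_le_two (stdPhi_pos t).le) (stdCdf_nonneg _)

lemma snPdf_le (l t : ℝ) : 2 * stdPhi t * stdCdf (l * t) ≤ 2 * stdPhi t :=
  mul_le_of_le_one_right (mul_nonneg zero_le_two (stdPhi_pos t).le) (stdCdf_le_one _)

lemma integrable_snPdf (l : ℝ) : Integrable fun t => 2 * stdPhi t * stdCdf (l * t) := by
  refine (integrable_stdPhi.const_mul 2).mono' (continuous_snPdf l).aestronglyMeasurable ?_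
  filter_upwards with t
  rw [Real.norm_of_nonneg (snPdf_nonneg l t)]
  exact snPdf_le l t

lemma integral_snPdf (l : ℝ) : ∫ t, 2 * stdPhi t * stdCdf (l * t) = 1 := by
  have h1 : ∫ t, 2 * stdPhi t * (1 - stdCdf (l * t)) = ∫ t, 2 * stdPhi t * stdCdf (l * t) := by
    rw [← integral_neg_eq_self]
    simp [stdPhi_neg, stdCdf_neg]
  have h2 : ∫ t, 2 * stdPhi t * (1 - stdCdf (l * t)) =
      (∫ t, 2 * stdPhi t) - ∫ t, 2 * stdPhi t * stdCdf (l * t) := by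
    rw [← integral_sub (integrable_stdPhi.const_mul 2) (integrable_snPdf l)]
    congr 1
    ext t
    ring
  rw [integral_const_mul, integral_stdPhi] at h2
  linarith

lemma hasDerivAt_snCdf (l x : ℝ) :
    HasDerivAt (snCdf l) (2 * stdPhi x * stdCdf (l * x)) x :=
  hasDerivAt_integral_Iic (continuous_snPdf l) (integrable_snPdf l) x

lemma tendsto_snCdf_atTop (l : ℝ) : Tendsto (snCdf l) atTop (nhds 1) :=
  integral_snPdf l ▸ tendsto_integral_Iic (integrable_snPdf l)

lemma monotone_snCdf (l : ℝ) : Monotone (snCdf l) :=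
  monotone_of_deriv_nonneg (fun x => (hasDerivAt_snCdf l x).differentiableAt)
    fun x => (hasDerivAt_snCdf l x).deriv ▸ snPdf_nonneg l x

lemma snCdf_nonneg (l x : ℝ) : 0 ≤ snCdf l x :=
  setIntegral_nonneg measurableSet_Iic fun t _ => snPdf_nonneg l t

lemma snCdf_le_one (l x : ℝ) : snCdf l x ≤ 1 :=
  (monotone_snCdf l).ge_of_tendsto (tendsto_snCdf_atTop l) x

lemma one_sub_snCdf_le (l : ℝ) {u : ℝ} (hu : 0 < u) : 1 - snCdf l u ≤ 2 * stdPhi u / u := by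
  have hlim : Tendsto (fun u : ℝ => snCdf l u - 1 + 2 * stdPhi u * u⁻¹) atTop (nhds 0) := by
    simpa using ((tendsto_snCdf_atTop l).sub_const 1).add
      ((tendsto_stdPhi_atTop.const_mul 2).mul tendsto_inv_atTop_zero)
  have := nonneg_of_deriv_nonpos_of_tendsto_zero
    (f' := fun u => 2 * stdPhi u * stdCdf (l * u) - 2 * stdPhi u - 2 * stdPhi u / u ^ 2)
    (fun x hx => ?_) (fun x hx => ?_) hlim hu
  · rw [div_eq_mul_inv]
    linarith
  · refine (((hasDerivAt_snCdf l x).sub_const 1).add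
      (((hasDerivAt_stdPhi x).const_mul 2).mul (hasDerivAt_inv hx.ne'))).congr_deriv ?_
    field_simp
    ring
  · have := snPdf_le l x
    have : 0 ≤ 2 * stdPhi x / x ^ 2 := by
      have := stdPhi_pos x
      positivity
    linarith

lemma le_one_sub_snCdf {l : ℝ} (hl : 0 < l) {u : ℝ} (hu : 0 < u) :
    2 * stdPhi u / u * (1 - (1 + 1 / l ^ 2) / u ^ 2) ≤ 1 - snCdf l u := by
  set c := 1 + 1 / l ^ 2 with hc
  have hlim : Tendsto (fun u : ℝ => 1 - snCdf l u - 2 * stdPhi u * (u⁻¹ - c * (u⁻¹) ^ 3))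
      atTop (nhds 0) := by
    simpa using ((tendsto_snCdf_atTop l).const_sub 1).sub
      ((tendsto_stdPhi_atTop.const_mul 2).mul (tendsto_inv_atTop_zero.sub
        ((tendsto_inv_atTop_zero.pow 3).const_mul c)))
  have := nonneg_of_deriv_nonpos_of_tendsto_zero
    (f' := fun u => 2 * stdPhi u *
      ((1 - stdCdf (l * u)) - 1 / (l * u) ^ 2 - 3 * c / u ^ 4))
    (fun x hx => ?_) (fun x hx => ?_) hlim hu
  · have e : 2 * stdPhi u / u * (1 - c / u ^ 2) = 2 * stdPhi u * (u⁻¹ - c * (u⁻¹) ^ 3) := by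
      field_simp
    linarith
  · refine (((hasDerivAt_snCdf l x).const_sub 1).sub
      (((hasDerivAt_stdPhi x).const_mul 2).mul ((hasDerivAt_inv hx.ne').sub
        (((hasDerivAt_inv hx.ne').pow 3).const_mul c)))).congr_deriv ?_
    rw [hc]
    simp only [Pi.pow_apply, Pi.sub_apply, Nat.cast_ofNat, Nat.add_one_sub_one, inv_pow]
    field_simp
    ring
  · refine mul_nonpos_of_nonneg_of_nonpos (mul_nonneg zero_le_two (stdPhi_pos x).le) ?_
    have h1 := one_sub_stdCdf_le (mul_pos hl hx)
    have h2 : 0 ≤ 3 * c / x ^ 4 := by positivity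
    linarith

lemma abs_one_sub_pow_sub_exp_le {p : ℝ} (hp0 : 0 ≤ p) (hp1 : p ≤ 1) {n : ℕ} (hn : 1 ≤ n) :
    |(1 - p) ^ n - Real.exp (-(n * p))| ≤ 6 / n := by
  have hn0 : (0 : ℝ) < n := by exact_mod_cast hn
  have h1 : 1 - p ≤ Real.exp (-p) := by linarith [Real.add_one_le_exp (-p)]
  have h2 : Real.exp (-p) - (1 - p) ≤ p ^ 2 := by
    have : Real.exp (-p) ≤ (1 + p)⁻¹ := by
      rw [Real.exp_neg]
      exact inv_anti₀ (by positivity) (by linarith [Real.add_one_le_exp p])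
    have h' : (1 + p)⁻¹ ≤ 1 - p + p ^ 2 := by
      rw [inv_le_iff_one_le_mul₀ (by positivity)]
      nlinarith [pow_nonneg hp0 3]
    linarith
  have h3 := abs_pow_sub_pow_le (1 - p) (Real.exp (-p)) n
  rw [abs_of_nonneg (a := 1 - p) (by linarith), abs_of_pos (Real.exp_pos _), max_eq_right h1,
    ← Real.exp_nat_mul, ← Real.exp_nat_mul, abs_sub_comm (1 - p), abs_of_nonneg (sub_nonneg.2 h1),
    mul_neg, Nat.cast_sub hn] at h3
  have h4 : Real.exp (((n : ℝ) - (1 : ℕ)) * -p) ≤ 3 * Real.exp (-(n * p)) := by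
    have e : ((n : ℝ) - (1 : ℕ)) * -p = p + -(n * p) := by push_cast; ring
    rw [e, Real.exp_add]
    gcongr
    exact (Real.exp_le_exp.2 hp1).trans (by linarith [Real.exp_one_lt_d9])
  have h5 : (n * p) ^ 2 * Real.exp (-(n * p)) ≤ 2 := by
    rw [Real.exp_neg, ← div_eq_mul_inv, div_le_iff₀ (Real.exp_pos _)]
    have := Real.quadratic_le_exp_of_nonneg (x := n * p) (by positivity)
    nlinarith [mul_nonneg hn0.le hp0]
  calc _ ≤ _ := h3
    _ ≤ p ^ 2 * n * (3 * Real.exp (-(n * p))) := by gcongr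
    _ = 3 * ((n * p) ^ 2 * Real.exp (-(n * p))) / n := by field_simp
    _ ≤ 6 / n := by gcongr; linarith

lemma abs_exp_neg_sub_exp_neg_le {a b m : ℝ} (ha : m ≤ a) (hb : m ≤ b) :
    |Real.exp (-a) - Real.exp (-b)| ≤ |a - b| * Real.exp (-m) := by
  have key : ∀ {a b : ℝ}, m ≤ a → a ≤ b →
      Real.exp (-a) - Real.exp (-b) ≤ (b - a) * Real.exp (-m) := by
    intro a b ha hab
    have e : Real.exp (-b) = Real.exp (-a) * Real.exp (a - b) := by
      rw [← Real.exp_add]; ring_nf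
    have h1 := Real.add_one_le_exp (a - b)
    have h2 : Real.exp (-a) ≤ Real.exp (-m) := Real.exp_le_exp.2 (by linarith)
    rw [e]
    nlinarith [Real.exp_pos (-a)]
  rcases le_total a b with h | h
  · rw [abs_of_nonneg (by simpa using h), abs_sub_comm, abs_of_nonneg (by linarith)]
    exact key ha h
  · rw [abs_sub_comm, abs_of_nonneg (by simpa using h), abs_of_nonneg (by linarith)]
    exact key hb h

lemma half_exp_le_scaled_tail {c s x : ℝ} (hs : 8 * c ≤ s) (hs0 : 0 < s) (hx0 : x ≤ 0)
    (hxs : -s / 2 ≤ x) :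
    Real.exp (-(3 / 4 * x)) / 2 ≤
      Real.exp (-x) * Real.exp (-(x ^ 2 / (2 * s))) / (1 + x / s) * (1 - 4 * c / s) := by
  have hD : 1 / 2 ≤ 1 - 4 * c / s := by
    have : 4 * c / s ≤ 1 / 2 := by rw [div_le_iff₀ hs0]; linarith
    linarith
  have ht0 : 0 < 1 + x / s := by
    have : -(1 / 2) ≤ x / s := by rw [le_div_iff₀ hs0]; linarith
    linarith
  have ht1 : 1 + x / s ≤ 1 := by
    have := div_nonpos_of_nonpos_of_nonneg hx0 hs0.le
    linarith
  have hE : Real.exp (-(3 / 4 * x)) ≤ Real.exp (-x) * Real.exp (-(x ^ 2 / (2 * s))) := by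
    rw [← Real.exp_add, Real.exp_le_exp]
    have : x ^ 2 / (2 * s) ≤ -x / 4 := by
      rw [div_le_iff₀ (by positivity)]
      nlinarith
    linarith
  calc Real.exp (-(3 / 4 * x)) / 2 = Real.exp (-(3 / 4 * x)) * (1 / 2) := by ring
    _ ≤ _ := by
      gcongr
      refine hE.trans (le_div_self (by positivity) ht0 ht1)

lemma exp_neg_half_exp_le (y : ℝ) : Real.exp (-(Real.exp y / 2)) ≤ 384 * Real.exp (-(4 * y)) := by
  have h := Real.pow_div_factorial_le_exp (x := Real.exp y / 2) (by positivity) 4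
  have e : (Real.exp y / 2) ^ 4 / (Nat.factorial 4 : ℕ) = Real.exp (4 * y) / 384 := by
    rw [div_pow, ← Real.exp_nat_mul]
    norm_num [Nat.factorial]
    ring
  rw [e] at h
  rw [Real.exp_neg, Real.exp_neg (4 * y), ← div_eq_mul_inv, inv_le_comm₀ (by positivity)
    (by positivity), inv_div]
  exact h

lemma abs_exp_neg_sub_gumbel_le_of_nonneg {c s x q : ℝ} (hc : 1 ≤ c) (hs : 8 * c ≤ s)
    (hx : 0 ≤ x)
    (hq : Real.exp (-x) * Real.exp (-(x ^ 2 / (2 * s))) / (1 + x / s) * (1 - 4 * c / s) ≤ q)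
    (hq' : q ≤ Real.exp (-x) * Real.exp (-(x ^ 2 / (2 * s))) / (1 + x / s)) :
    |Real.exp (-q) - Real.exp (-Real.exp (-x))| ≤ 4 * c / s := by
  have hs0 : 0 < s := by linarith
  have hxs : 0 ≤ x / s := by positivity
  rw [mul_div_assoc] at hq hq'
  set A := Real.exp (-(x ^ 2 / (2 * s))) / (1 + x / s) with hA
  have hA0 : 0 < A := by positivity
  have hA1 : A ≤ 1 := by
    rw [hA]
    refine div_le_one_of_le₀ ?_ (by positivity)
    have : Real.exp (-(x ^ 2 / (2 * s))) ≤ 1 := by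
      rw [Real.exp_le_one_iff, neg_nonpos]
      positivity
    linarith
  have hA2 : 1 - x ^ 2 / (2 * s) - x / s ≤ A := by
    rw [hA, le_div_iff₀ (by positivity)]
    have := Real.add_one_le_exp (-(x ^ 2 / (2 * s)))
    have h2 : 0 ≤ x ^ 2 / (2 * s) := by positivity
    nlinarith [mul_nonneg h2 hxs, mul_nonneg hxs hxs]
  have hD : 4 * c / s ≤ 1 / 2 := by rw [div_le_iff₀ hs0]; linarith
  have hD0 : 0 ≤ 4 * c / s := by positivity
  have hE := Real.exp_pos (-x)
  have hq0 : 0 ≤ q := le_trans (mul_nonneg (by positivity) (by linarith)) hq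
  have h1 := abs_exp_neg_sub_exp_neg_le hq0 hE.le
  rw [neg_zero, Real.exp_zero, mul_one] at h1
  refine h1.trans ?_
  have hqE : q ≤ Real.exp (-x) := hq'.trans (mul_le_of_le_one_right hE.le hA1)
  rw [abs_sub_comm, abs_of_nonneg (by linarith)]
  have hAD : 1 - (x ^ 2 / 2 + x + 4 * c) / s ≤ A * (1 - 4 * c / s) := by
    have e : (x ^ 2 / 2 + x + 4 * c) / s = x ^ 2 / (2 * s) + x / s + 4 * c / s := by
      field_simp
    rw [e]
    nlinarith
  have hpoly : Real.exp (-x) * (x ^ 2 / 2 + x + 4 * c) ≤ 4 * c := by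
    rw [Real.exp_neg, inv_mul_le_iff₀ (Real.exp_pos x)]
    have := Real.quadratic_le_exp_of_nonneg hx
    nlinarith [sq_nonneg x]
  calc Real.exp (-x) - q
      ≤ Real.exp (-x) - Real.exp (-x) * (A * (1 - 4 * c / s)) := by linarith
    _ ≤ Real.exp (-x) * ((x ^ 2 / 2 + x + 4 * c) / s) := by nlinarith
    _ = Real.exp (-x) * (x ^ 2 / 2 + x + 4 * c) / s := by ring
    _ ≤ 4 * c / s := by gcongr

lemma abs_exp_neg_sub_gumbel_le_of_nonpos {c s x q : ℝ} (hc : 1 ≤ c) (hs : 8 * c ≤ s)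
    (hx : x ≤ 0) (hxs : -s / 2 ≤ x)
    (hq : Real.exp (-x) * Real.exp (-(x ^ 2 / (2 * s))) / (1 + x / s) * (1 - 4 * c / s) ≤ q)
    (hq' : q ≤ Real.exp (-x) * Real.exp (-(x ^ 2 / (2 * s))) / (1 + x / s)) :
    |Real.exp (-q) - Real.exp (-Real.exp (-x))| ≤ 384 * (3 + 4 * c) / s := by
  have hs0 : 0 < s := by linarith
  have hm : Real.exp (-(3 / 4 * x)) / 2 ≤ q :=
    (half_exp_le_scaled_tail hs hs0 hx hxs).trans hq
  have hm' : Real.exp (-(3 / 4 * x)) / 2 ≤ Real.exp (-x) := by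
    have : Real.exp (-(3 / 4 * x)) ≤ Real.exp (-x) := Real.exp_le_exp.2 (by linarith)
    linarith [Real.exp_pos (-x)]
  have h1 := abs_exp_neg_sub_exp_neg_le hm hm'
  have h2 := exp_neg_half_exp_le (-(3 / 4 * x))
  obtain ⟨y, rfl⟩ : ∃ y, x = -y := ⟨-x, by ring⟩
  have hy : 0 ≤ y := by linarith
  rw [mul_div_assoc] at hq hq'
  set A := Real.exp (-((-y) ^ 2 / (2 * s))) / (1 + -y / s) with hA
  have hys : y / s ≤ 1 / 2 := by rw [div_le_iff₀ hs0]; linarith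
  have hys0 : 0 ≤ y / s := by positivity
  have ht : 0 < 1 + -y / s := by rw [neg_div]; linarith
  have hA0 : 0 < A := by positivity
  have hA1 : A ≤ 1 + 2 * (y / s) := by
    rw [hA, div_le_iff₀ ht, neg_div]
    have : Real.exp (-((-y) ^ 2 / (2 * s))) ≤ 1 := by
      rw [Real.exp_le_one_iff, neg_nonpos]
      positivity
    nlinarith
  have hA2 : 1 - y ^ 2 / (2 * s) ≤ A := by
    have := Real.add_one_le_exp (-((-y) ^ 2 / (2 * s)))
    have h3 : Real.exp (-((-y) ^ 2 / (2 * s))) ≤ A :=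
      le_div_self (Real.exp_pos _).le ht (by rw [neg_div]; linarith)
    rw [neg_sq] at this h3
    linarith
  have hD : 4 * c / s ≤ 1 / 2 := by rw [div_le_iff₀ hs0]; linarith
  have hD0 : 0 ≤ 4 * c / s := by positivity
  have hy2 : 0 ≤ y ^ 2 / (2 * s) := by positivity
  have e : (2 * y + y ^ 2 / 2 + 4 * c) / s = 2 * (y / s) + y ^ 2 / (2 * s) + 4 * c / s := by
    field_simp
  rw [neg_neg] at *
  have hE := Real.exp_pos y
  have h3 : |q - Real.exp y| ≤ Real.exp y * ((2 * y + y ^ 2 / 2 + 4 * c) / s) := by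
    rw [e, abs_le]
    constructor
    · have : 1 - y ^ 2 / (2 * s) - 4 * c / s ≤ A * (1 - 4 * c / s) := by nlinarith
      nlinarith [mul_le_mul_of_nonneg_left this hE.le, mul_nonneg hE.le hys0]
    · nlinarith [mul_le_mul_of_nonneg_left hA1 hE.le, mul_nonneg hE.le hy2, mul_nonneg hE.le hD0]
  have h4 : Real.exp (-(2 * y)) * (2 * y + y ^ 2 / 2 + 4 * c) ≤ 3 + 4 * c := by
    rw [Real.exp_neg, inv_mul_le_iff₀ (Real.exp_pos _)]
    have := Real.quadratic_le_exp_of_nonneg (x := 2 * y) (by positivity)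
    nlinarith [sq_nonneg y]
  calc _ ≤ _ := h1
    _ ≤ Real.exp y * ((2 * y + y ^ 2 / 2 + 4 * c) / s) *
        (384 * Real.exp (-(4 * -(3 / 4 * -y)))) := by gcongr
    _ = 384 * (Real.exp (-(2 * y)) * (2 * y + y ^ 2 / 2 + 4 * c)) / s := by
      have : Real.exp (-(2 * y)) = Real.exp y * Real.exp (-(4 * -(3 / 4 * -y))) := by
        rw [← Real.exp_add]; ring_nf
      rw [this]
      ring
    _ ≤ _ := by gcongr

lemma abs_exp_neg_sub_gumbel_le_of_le {s x q : ℝ} (hs : 0 < s) (hx : x ≤ -s / 2)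
    (hq : Real.exp (-(3 / 4 * (-s / 2))) / 2 ≤ q) :
    |Real.exp (-q) - Real.exp (-Real.exp (-x))| ≤ 6 / s := by
  set m := Real.exp (-(3 / 4 * (-s / 2))) / 2 with hm
  have hm' : m ≤ Real.exp (-x) := by
    have : Real.exp (-(3 / 4 * (-s / 2))) ≤ Real.exp (-x) := Real.exp_le_exp.2 (by linarith)
    linarith [Real.exp_pos (-x)]
  have h1 : Real.exp (-m) ≤ 6 / s := by
    rw [Real.exp_neg, inv_le_comm₀ (Real.exp_pos _) (by positivity), inv_div]
    have := Real.add_one_le_exp (-(3 / 4 * (-s / 2)))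
    have := Real.add_one_le_exp m
    linarith
  have h2 : Real.exp (-q) ≤ Real.exp (-m) := Real.exp_le_exp.2 (by linarith)
  have h3 : Real.exp (-Real.exp (-x)) ≤ Real.exp (-m) := Real.exp_le_exp.2 (by linarith)
  rw [abs_le]
  constructor <;> linarith [Real.exp_pos (-q), Real.exp_pos (-Real.exp (-x))]

lemma norming_mul_stdPhi_div {β N x : ℝ} (hβ : 0 < β)
    (hN : Real.sqrt (Real.pi / 2) * β * Real.exp (β ^ 2 / 2) = N) :
    N * (2 * stdPhi (β⁻¹ * x + β) / (β⁻¹ * x + β)) =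
      Real.exp (-x) * Real.exp (-(x ^ 2 / (2 * β ^ 2))) / (1 + x / β ^ 2) := by
  have hu : β⁻¹ * x + β = β * (1 + x / β ^ 2) := by field_simp; ring
  have hexp : Real.exp (β ^ 2 / 2) * Real.exp (-(β⁻¹ * x + β) ^ 2 / 2) =
      Real.exp (-x) * Real.exp (-(x ^ 2 / (2 * β ^ 2))) := by
    rw [← Real.exp_add, ← Real.exp_add]
    congr 1
    field_simp
    ring
  have hsqrt : Real.sqrt (Real.pi / 2) * (2 * (Real.sqrt (2 * Real.pi))⁻¹) = 1 := by
    have : Real.sqrt (2 * Real.pi) = 2 * Real.sqrt (Real.pi / 2) := by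
      rw [show 2 * Real.pi = 2 ^ 2 * (Real.pi / 2) by ring, Real.sqrt_mul (by positivity),
        Real.sqrt_sq zero_le_two]
    have h0 : 0 < Real.sqrt (Real.pi / 2) := Real.sqrt_pos.2 (by positivity)
    rw [this]
    field_simp
  rw [← hexp, ← hN, stdPhi]
  nth_rw 2 [hu]
  calc _ = (Real.sqrt (Real.pi / 2) * (2 * (Real.sqrt (2 * Real.pi))⁻¹)) * (β / β) *
        (Real.exp (β ^ 2 / 2) * Real.exp (-(β⁻¹ * x + β) ^ 2 / 2) / (1 + x / β ^ 2)) := by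
        simp only [div_eq_mul_inv, mul_inv]
        ring
    _ = _ := by rw [hsqrt, div_self hβ.ne', one_mul, one_mul]

lemma scaled_tail_bounds {l β N x : ℝ} (hl : 0 < l) (hβ : 0 < β)
    (hN : Real.sqrt (Real.pi / 2) * β * Real.exp (β ^ 2 / 2) = N) (hx : -β ^ 2 / 2 ≤ x) :
    Real.exp (-x) * Real.exp (-(x ^ 2 / (2 * β ^ 2))) / (1 + x / β ^ 2) *
        (1 - 4 * (1 + 1 / l ^ 2) / β ^ 2) ≤ N * (1 - snCdf l (β⁻¹ * x + β)) ∧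
      N * (1 - snCdf l (β⁻¹ * x + β)) ≤
        Real.exp (-x) * Real.exp (-(x ^ 2 / (2 * β ^ 2))) / (1 + x / β ^ 2) := by
  have hN0 : 0 ≤ N := by rw [← hN]; positivity
  have hu : β / 2 ≤ β⁻¹ * x + β := by
    have : β⁻¹ * (-β ^ 2 / 2) ≤ β⁻¹ * x := by gcongr
    have e : β⁻¹ * (-β ^ 2 / 2) = -β / 2 := by field_simp
    linarith
  have hu0 : 0 < β⁻¹ * x + β := by linarith
  rw [← norming_mul_stdPhi_div hβ hN]
  constructor
  · rw [mul_assoc]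
    refine mul_le_mul_of_nonneg_left (le_trans ?_ (le_one_sub_snCdf hl hu0)) hN0
    have hφ := stdPhi_pos (β⁻¹ * x + β)
    refine mul_le_mul_of_nonneg_left (sub_le_sub_left ?_ 1) (by positivity)
    rw [div_le_div_iff₀ (by positivity) (by positivity)]
    have h2 : β ^ 2 ≤ 4 * (β⁻¹ * x + β) ^ 2 := by nlinarith
    have h3 : (0 : ℝ) ≤ 1 + 1 / l ^ 2 := by positivity
    nlinarith
  · exact mul_le_mul_of_nonneg_left (one_sub_snCdf_le l hu0) hN0

lemma abs_snCdf_pow_sub_gumbel_le {l β : ℝ} (hl : 0 < l) (hβ : 1 ≤ β) {n : ℕ} (hn : 1 ≤ n)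
    (hN : Real.sqrt (Real.pi / 2) * β * Real.exp (β ^ 2 / 2) = n) (x : ℝ) :
    |snCdf l (β⁻¹ * x + β) ^ n - Real.exp (-Real.exp (-x))| ≤
      (384 * (3 + 4 * (1 + 1 / l ^ 2)) + 12) / β ^ 2 := by
  set c := 1 + 1 / l ^ 2 with hc
  have hc1 : 1 ≤ c := by
    rw [hc]
    have : 0 ≤ 1 / l ^ 2 := by positivity
    linarith
  have hβ0 : 0 < β := by linarith
  have hs0 : 0 < β ^ 2 := by positivity
  have hn0 : (0 : ℝ) < n := by exact_mod_cast hn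
  rcases lt_or_ge (β ^ 2) (8 * c) with hs | hs
  · have h1 : |snCdf l (β⁻¹ * x + β) ^ n - Real.exp (-Real.exp (-x))| ≤ 1 := by
      have h2 := pow_nonneg (snCdf_nonneg l (β⁻¹ * x + β)) n
      have h3 := pow_le_one₀ (snCdf_nonneg l (β⁻¹ * x + β)) (snCdf_le_one l _) (n := n)
      have h4 := Real.exp_pos (-Real.exp (-x))
      have h5 : Real.exp (-Real.exp (-x)) ≤ 1 :=
        Real.exp_le_one_iff.2 (neg_nonpos.2 (Real.exp_pos _).le)
      rw [abs_le]
      constructor <;> linarith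
    refine h1.trans ?_
    rw [le_div_iff₀ hs0]
    linarith
  set p := 1 - snCdf l (β⁻¹ * x + β) with hp
  have hp0 : 0 ≤ p := sub_nonneg.2 (snCdf_le_one l _)
  have hp1 : p ≤ 1 := by linarith [snCdf_nonneg l (β⁻¹ * x + β)]
  have h1 := abs_one_sub_pow_sub_exp_le hp0 hp1 hn
  have hsn : β ^ 2 / 2 ≤ n := by
    rw [← hN]
    have h2 : 1 ≤ Real.sqrt (Real.pi / 2) := by
      rw [Real.one_le_sqrt]
      linarith [Real.pi_gt_three]
    have h3 := Real.add_one_le_exp (β ^ 2 / 2)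
    have h4 : 1 ≤ Real.sqrt (Real.pi / 2) * β := one_le_mul_of_one_le_of_one_le h2 hβ
    nlinarith
  have h12 : (6 : ℝ) / n ≤ 12 / β ^ 2 := by
    rw [div_le_div_iff₀ hn0 hs0]
    linarith
  have hq : |Real.exp (-(n * p)) - Real.exp (-Real.exp (-x))| ≤
      384 * (3 + 4 * c) / β ^ 2 := by
    rcases le_total x (-β ^ 2 / 2) with hx | hx
    · have hlow := (scaled_tail_bounds hl hβ0 hN le_rfl).1
      have hmono : (n : ℝ) * (1 - snCdf l (β⁻¹ * (-β ^ 2 / 2) + β)) ≤ n * p := by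
        rw [hp]
        gcongr
        exact monotone_snCdf l (by gcongr)
      have hhalf := half_exp_le_scaled_tail hs hs0 (x := -β ^ 2 / 2) (by linarith) le_rfl
      refine (abs_exp_neg_sub_gumbel_le_of_le hs0 hx (hhalf.trans (hlow.trans hmono))).trans ?_
      gcongr
      linarith
    · obtain ⟨hlow, hupp⟩ := scaled_tail_bounds hl hβ0 hN hx
      rcases le_total 0 x with hx0 | hx0
      · refine (abs_exp_neg_sub_gumbel_le_of_nonneg hc1 hs hx0 hlow hupp).trans ?_
        exact div_le_div_of_nonneg_right (by linarith) hs0.le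
      · exact abs_exp_neg_sub_gumbel_le_of_nonpos hc1 hs hx0 hx hlow hupp
  have e : snCdf l (β⁻¹ * x + β) = 1 - p := by rw [hp]; ring
  rw [e, add_div]
  calc _ ≤ _ := abs_sub_le _ (Real.exp (-(n * p))) _
    _ ≤ _ := by linarith

lemma one_le_norming {β : ℝ} (hβ : 0 < β)
    (h : 9 ≤ Real.sqrt (Real.pi / 2) * β * Real.exp (β ^ 2 / 2)) : 1 ≤ β := by
  by_contra! hlt
  have h1 : Real.sqrt (Real.pi / 2) ≤ 2 := by
    rw [Real.sqrt_le_left zero_le_two]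
    linarith [Real.pi_le_four]
  have h2 : Real.exp (β ^ 2 / 2) ≤ 3 :=
    (Real.exp_le_exp.2 (by nlinarith)).trans (Real.exp_one_lt_d9.le.trans (by norm_num))
  have : Real.sqrt (Real.pi / 2) * β * Real.exp (β ^ 2 / 2) ≤ 2 * 1 * 3 := by gcongr
  linarith

lemma log_le_two_mul_sq {β N : ℝ} (hβ : 0 < β)
    (hN : Real.sqrt (Real.pi / 2) * β * Real.exp (β ^ 2 / 2) = N) :
    Real.log N ≤ 2 * β ^ 2 := by
  have h1 : Real.sqrt (Real.pi / 2) ≤ 2 := by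
    rw [Real.sqrt_le_left zero_le_two]
    linarith [Real.pi_le_four]
  have h0 : 0 < Real.sqrt (Real.pi / 2) := Real.sqrt_pos.2 (by positivity)
  rw [← hN, Real.log_le_iff_le_exp (by positivity)]
  have h2 : Real.sqrt (Real.pi / 2) * β ≤ Real.exp (β ^ 2) := by
    have := Real.add_one_le_exp (β ^ 2)
    nlinarith [sq_nonneg (β - 1)]
  calc _ ≤ Real.exp (β ^ 2) * Real.exp (β ^ 2 / 2) := by gcongr
    _ ≤ Real.exp (2 * β ^ 2) := by
      rw [← Real.exp_add, Real.exp_le_exp]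
      nlinarith [sq_nonneg β]

theorem stmt_11 (l : ℝ) (hl : 0 < l) (b : ℕ → ℝ)
    (hb : ∀ n : ℕ, 1 ≤ n → 0 < b n ∧
      Real.sqrt (Real.pi / 2) * b n * Real.exp ((b n) ^ 2 / 2) = n) :
    ∃ C > 0, ∀ n : ℕ, 9 ≤ n →
      (⨆ x : ℝ, |(snCdf l ((b n)⁻¹ * x + b n)) ^ n - Real.exp (-Real.exp (-x))|) <
        C / Real.log n := by
  set K := 384 * (3 + 4 * (1 + 1 / l ^ 2)) + 12 with hK
  have hK0 : 0 < K := by positivity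
  refine ⟨2 * K + 1, by positivity, fun n hn => ?_⟩
  obtain ⟨hβ, hN⟩ := hb n (by lia)
  have hn9 : (9 : ℝ) ≤ n := by exact_mod_cast hn
  have hlog : 0 < Real.log n := Real.log_pos (by linarith)
  have hβ1 : 1 ≤ b n := one_le_norming hβ (hN ▸ hn9)
  refine (ciSup_le fun x => abs_snCdf_pow_sub_gumbel_le hl hβ1 (by lia) hN x).trans_lt ?_
  have h1 := log_le_two_mul_sq hβ hN
  have hs0 : 0 < b n ^ 2 := by positivity
  rw [← hK, div_lt_div_iff₀ hs0 hlog]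
  nlinarith
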